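/- Let 𝒢 be a compact principal ample groupoid with orbit equivalence relation 𝓡. Then: (i) the map (r, s) : 𝒢 → 𝒢⁰ × 𝒢⁰ is a homeomorphism onto its image 𝓡, and 𝓡 is closed in 𝒢⁰ × 𝒢⁰; (ii) the orbit space 𝒢⁰/𝓡 is compact, Hausdorff and totally disconnected; (iii) the canonical projection q : 𝒢⁰ → 𝒢⁰/𝓡 is a local homeomorphism. -/

import Mathlib

universe u

/-- The algebraic operations of a groupoid (identified with its set of arrows):
a (partially meaningful) composition `gmul` and an inversion `ginv`.  The product
`gmul g h` is only required to behave like composition when `g` and `h` are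
composable, i.e. when `src g = rng h`. -/
class GroupoidOps (G : Type u) where
  gmul : G → G → G
  ginv : G → G

namespace GroupoidOps

variable {G : Type u} [GroupoidOps G]

/-- The source map `s g = g⁻¹ g`. -/
def src (g : G) : G := gmul (ginv g) g

/-- The range map `r g = g g⁻¹`. -/
def rng (g : G) : G := gmul g (ginv g)

/-- The unit space `𝒢⁰`: the set of identity arrows. -/
def unitSpace (G : Type u) [GroupoidOps G] : Set G := {x : G | src x = x}

end GroupoidOps

open GroupoidOps

/-- A topological groupoid: a groupoid `G`, identified with its arrow space, equipped
with a topology such that inversion is continuous and composition is continuous on the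
set of composable pairs. -/
class TopologicalGroupoid (G : Type u) extends TopologicalSpace G, GroupoidOps G where
  ginv_ginv : ∀ g : G, ginv (ginv g) = g
  gmul_src : ∀ g : G, gmul g (src g) = g
  rng_gmul : ∀ g : G, gmul (rng g) g = g
  gmul_assoc : ∀ g h k : G, src g = rng h → src h = rng k →
    gmul (gmul g h) k = gmul g (gmul h k)
  src_gmul : ∀ g h : G, src g = rng h → src (gmul g h) = src h
  rng_gmul_comp : ∀ g h : G, src g = rng h → rng (gmul g h) = rng g
  ginv_gmul : ∀ g h : G, src g = rng h → ginv (gmul g h) = gmul (ginv h) (ginv g)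
  ginv_unit : ∀ x : G, src x = x → ginv x = x
  src_src : ∀ g : G, src (src g) = src g
  src_rng : ∀ g : G, src (rng g) = rng g
  continuous_ginv : Continuous (ginv : G → G)
  continuous_gmul : Continuous fun p : {p : G × G // src p.1 = rng p.2} => gmul p.1.1 p.1.2

/-- An ample groupoid: a topological groupoid (not necessarily Hausdorff) whose unit
space is locally compact, Hausdorff and totally disconnected in the subspace topology,
and whose source map, viewed as a map `G → 𝒢⁰`, is a local homeomorphism. -/
class AmpleGroupoid (G : Type u) extends TopologicalGroupoid G where
  t2_unitSpace : T2Space (unitSpace G)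
  locallyCompact_unitSpace : LocallyCompactSpace (unitSpace G)
  totallyDisconnected_unitSpace : TotallyDisconnectedSpace (unitSpace G)
  isLocalHomeomorph_src :
    IsLocalHomeomorph fun g : G => (⟨src g, TopologicalGroupoid.src_src g⟩ : unitSpace G)

namespace TopologicalGroupoid

variable {G : Type u} [TopologicalGroupoid G]

/-- A bisection: an open subset on which both the source and the range map are injective. -/
def IsBisection (U : Set G) : Prop :=
  IsOpen U ∧ Set.InjOn (src : G → G) U ∧ Set.InjOn (rng : G → G) U

/-- A compact bisection: a bisection which is compact
(quasi-compact and Hausdorff in the subspace topology). -/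
def IsCompactBisection (U : Set G) : Prop :=
  IsBisection U ∧ IsCompact U ∧ T2Space U

/-- Setwise inverse `U⁻¹ = { u⁻¹ : u ∈ U }`. -/
def setInv (U : Set G) : Set G := ginv '' U

/-- Setwise product `UV = { uv : u ∈ U, v ∈ V, s(u) = r(v) }`. -/
def setMul (U V : Set G) : Set G :=
  {x : G | ∃ u ∈ U, ∃ v ∈ V, src u = rng v ∧ x = gmul u v}

/-- A subgroupoid: a subset closed under inversion and (composable) composition. -/
def IsSubgroupoid (H : Set G) : Prop :=
  (∀ g ∈ H, ginv g ∈ H) ∧ ∀ g ∈ H, ∀ h ∈ H, src g = rng h → gmul g h ∈ H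

/-- A groupoid is principal if every isotropy element is a unit. -/
def IsPrincipal (G : Type u) [TopologicalGroupoid G] : Prop :=
  ∀ g : G, src g = rng g → g ∈ unitSpace G

/-- The orbit of `x`, namely `r(s⁻¹(x))`. -/
def orbit (x : G) : Set G := {y : G | ∃ g : G, src g = x ∧ rng g = y}

/-- A subset of the unit space is invariant if it is a union of orbits. -/
def IsInvariant (U : Set G) : Prop := ∀ g : G, src g ∈ U → rng g ∈ U

/-- An inverse semigroup of compact bisections: a nonempty collection of compact
bisections closed under setwise product and setwise inverse. -/
def IsInvSemigroupOfCompactBisections (S : Set (Set G)) : Prop :=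
  S.Nonempty ∧ (∀ U ∈ S, IsCompactBisection U) ∧
    (∀ U ∈ S, setInv U ∈ S) ∧ ∀ U ∈ S, ∀ V ∈ S, setMul U V ∈ S

/-- The orbit equivalence relation `𝓡` on the unit space. -/
def orbitRel (G : Type u) [TopologicalGroupoid G] :
    unitSpace G → unitSpace G → Prop :=
  fun x y => ∃ g : G, src g = (x : G) ∧ rng g = (y : G)

end TopologicalGroupoid

open TopologicalGroupoid

namespace TopologicalGroupoid

variable {G : Type u} [TopologicalGroupoid G]

theorem src_ginv (g : G) : src (ginv g) = rng g := by
  simp only [src, rng, ginv_ginv]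

theorem rng_ginv (g : G) : rng (ginv g) = src g := by
  simp only [src, rng, ginv_ginv]

theorem rng_of_mem_unitSpace {x : G} (hx : x ∈ unitSpace G) : rng x = x := by
  rw [← src_ginv, ginv_unit x hx, hx]

theorem orbitRel_equivalence (G : Type u) [TopologicalGroupoid G] : Equivalence (orbitRel G) where
  refl x := ⟨x, x.2, rng_of_mem_unitSpace x.2⟩
  symm := by
    rintro x y ⟨g, hs, hr⟩
    exact ⟨ginv g, by rw [src_ginv, hr], by rw [rng_ginv, hs]⟩
  trans := by
    rintro x y z ⟨g, hgs, hgr⟩ ⟨h, hhs, hhr⟩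
    have hc : src h = rng g := hhs.trans hgr.symm
    exact ⟨gmul h g, by rw [src_gmul h g hc, hgs], by rw [rng_gmul_comp h g hc, hhr]⟩

theorem quot_mk_eq_iff_orbitRel {x y : unitSpace G} :
    Quot.mk (orbitRel G) x = Quot.mk (orbitRel G) y ↔ orbitRel G x y := by
  rw [Quot.eq, (orbitRel_equivalence G).eqvGen_iff]

/-- In a principal groupoid an arrow is determined by its range and source. -/
theorem IsPrincipal.eq_of_rng_eq_of_src_eq (hprin : IsPrincipal G) {g h : G}
    (hr : rng g = rng h) (hs : src g = src h) : g = h := by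
  have hc : src g = rng (ginv h) := by rw [rng_ginv, hs]
  have hsrc : src (gmul g (ginv h)) = rng h := by rw [src_gmul g _ hc, src_ginv]
  have hunit : gmul g (ginv h) = rng h := by
    rw [← hsrc]
    exact (hprin _ (by rw [hsrc, rng_gmul_comp g _ hc, hr])).symm
  calc
    g = gmul g (gmul (ginv h) h) := by rw [← src, ← hs, gmul_src]
    _ = gmul (gmul g (ginv h)) h := (gmul_assoc g _ h hc (src_ginv h)).symm
    _ = h := by rw [hunit, rng_gmul]

end TopologicalGroupoid

namespace AmpleGroupoid

variable {G : Type u} [AmpleGroupoid G]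

attribute [local instance] t2_unitSpace totallyDisconnected_unitSpace

theorem isLocalHomeomorph_rng :
    IsLocalHomeomorph fun g : G => (⟨rng g, src_rng g⟩ : unitSpace G) := by
  let e : G ≃ₜ G :=
    { Function.Involutive.toPerm (ginv : G → G) ginv_ginv with
      continuous_toFun := continuous_ginv
      continuous_invFun := continuous_ginv }
  convert isLocalHomeomorph_src.comp e.isLocalHomeomorph using 2 with g
  exact Subtype.ext (src_ginv g).symm

theorem isOpen_unitSpace : IsOpen (unitSpace G) := by
  have h : IsLocalHomeomorph (Subtype.val : unitSpace G → G) := by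
    refine IsLocalHomeomorph.of_comp ?_ isLocalHomeomorph_src continuous_subtype_val
    convert (Homeomorph.refl (unitSpace G)).isLocalHomeomorph using 1
    funext x
    exact Subtype.ext x.2
  simpa using h.isOpenMap.isOpen_range

theorem compactSpace_unitSpace [CompactSpace G] : CompactSpace (unitSpace G) :=
  Function.Surjective.compactSpace (f := fun g : G => (⟨src g, src_src g⟩ : unitSpace G))
    isLocalHomeomorph_src.continuous (fun x => ⟨x, Subtype.ext x.2⟩)

theorem isClosedEmbedding_rng_src [CompactSpace G] (hprin : IsPrincipal G) :
    Topology.IsClosedEmbedding (fun g : G =>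
      ((⟨rng g, src_rng g⟩ : unitSpace G), (⟨src g, src_src g⟩ : unitSpace G))) := by
  refine (isLocalHomeomorph_rng.continuous.prodMk
    isLocalHomeomorph_src.continuous).isClosedEmbedding ?_
  intro g h hgh
  obtain ⟨hr, hs⟩ := Prod.mk.inj hgh
  exact hprin.eq_of_rng_eq_of_src_eq (congrArg Subtype.val hr) (congrArg Subtype.val hs)

theorem isOpenQuotientMap_quot_mk_orbitRel : IsOpenQuotientMap (Quot.mk (orbitRel G)) := by
  refine ⟨Quot.mk_surjective, continuous_quot_mk, fun U hU => ?_⟩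
  rw [← isQuotientMap_quot_mk.isOpen_preimage]
  convert isLocalHomeomorph_rng.isOpenMap _ (hU.preimage isLocalHomeomorph_src.continuous) using 1
  ext y
  constructor
  · rintro ⟨x, hx, hxy⟩
    obtain ⟨g, hs, hr⟩ := quot_mk_eq_iff_orbitRel.1 hxy
    refine ⟨g, ?_, Subtype.ext hr⟩
    have : (⟨src g, src_src g⟩ : unitSpace G) = x := Subtype.ext hs
    simpa [this] using hx
  · rintro ⟨g, hg, rfl⟩
    exact ⟨_, hg, quot_mk_eq_iff_orbitRel.2 ⟨g, rfl, rfl⟩⟩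

theorem isLocalHomeomorph_quot_mk_orbitRel
    (hemb : Topology.IsEmbedding (fun g : G =>
      ((⟨rng g, src_rng g⟩ : unitSpace G), (⟨src g, src_src g⟩ : unitSpace G)))) :
    IsLocalHomeomorph (Quot.mk (orbitRel G)) := by
  obtain ⟨W, hW, hWeq⟩ := hemb.isOpen_iff.1 (isOpen_unitSpace (G := G))
  rw [isLocalHomeomorph_iff_isOpenEmbedding_restrict]
  intro x
  have hx : (x, x) ∈ W := by
    have h : ((⟨rng x, src_rng _⟩ : unitSpace G), (⟨src x, src_src _⟩ : unitSpace G)) ∈ W :=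
      hWeq.ge x.2
    have hr : (⟨rng x, src_rng _⟩ : unitSpace G) = x := Subtype.ext (rng_of_mem_unitSpace x.2)
    have hs : (⟨src x, src_src _⟩ : unitSpace G) = x := Subtype.ext x.2
    rwa [hr, hs] at h
  obtain ⟨U, V, hU, hV, hxU, hxV, hUV⟩ := isOpen_prod_iff.1 hW x x hx
  refine ⟨U ∩ V, (hU.inter hV).mem_nhds ⟨hxU, hxV⟩, ?_⟩
  refine .of_continuous_injective_isOpenMap
    (isOpenQuotientMap_quot_mk_orbitRel.continuous.comp continuous_subtype_val) ?_
    (isOpenQuotientMap_quot_mk_orbitRel.isOpenMap.comp (hU.inter hV).isOpenMap_subtype_val)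
  rintro ⟨y, hy⟩ ⟨z, hz⟩ hyz
  obtain ⟨g, hs, hr⟩ := quot_mk_eq_iff_orbitRel.1 hyz
  have hsy : (⟨src g, src_src g⟩ : unitSpace G) = y := Subtype.ext hs
  have hrz : (⟨rng g, src_rng g⟩ : unitSpace G) = z := Subtype.ext hr
  have hg : g ∈ unitSpace G := by
    rw [← hWeq, Set.mem_preimage, hsy, hrz]
    exact hUV ⟨hz.1, hy.2⟩
  exact Subtype.ext (Subtype.ext (by rw [← hs, ← hr, rng_of_mem_unitSpace hg, hg]))

theorem t2Space_quot_orbitRel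
    (hclosed : IsClosed (Set.range fun g : G =>
      ((⟨rng g, src_rng g⟩ : unitSpace G), (⟨src g, src_src g⟩ : unitSpace G)))) :
    T2Space (Quot (orbitRel G)) := by
  rw [t2Space_iff_of_isOpenQuotientMap isOpenQuotientMap_quot_mk_orbitRel]
  convert hclosed using 1
  ext ⟨x, y⟩
  rw [Set.mem_ofPred_eq, eq_comm, quot_mk_eq_iff_orbitRel]
  simp only [orbitRel, Set.mem_range, Prod.mk.injEq, Subtype.ext_iff, and_comm]

theorem totallyDisconnectedSpace_quot_orbitRel [CompactSpace G] [T2Space (Quot (orbitRel G))] :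
    TotallyDisconnectedSpace (Quot (orbitRel G)) := by
  have := compactSpace_unitSpace (G := G)
  have : TotallySeparatedSpace (Quot (orbitRel G)) := by
    refine totallySeparatedSpace_iff_exists_isClopen.2 fun a b hab => ?_
    obtain ⟨x, rfl⟩ := Quot.mk_surjective a
    obtain ⟨V, hV, hxV, hVb⟩ := compact_exists_isClopen_in_isOpen
      (isOpen_compl_singleton.preimage (continuous_quot_mk (r := orbitRel G)))
      (show x ∈ Quot.mk (orbitRel G) ⁻¹' {b}ᶜ from hab)
    refine ⟨Quot.mk (orbitRel G) '' V,
      ⟨(hV.isClosed.isCompact.image continuous_quot_mk).isClosed,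
        isOpenQuotientMap_quot_mk_orbitRel.isOpenMap _ hV.isOpen⟩, ⟨x, hxV, rfl⟩, ?_⟩
    rintro ⟨y, hy, hyb⟩
    exact hVb hy hyb
  infer_instance

end AmpleGroupoid

/-- Let `𝒢` be a compact principal ample groupoid with orbit
equivalence relation `𝓡`.  Then (i) `(r, s) : 𝒢 → 𝒢⁰ × 𝒢⁰` is a homeomorphism onto its
image `𝓡` (an embedding), and `𝓡` is closed in `𝒢⁰ × 𝒢⁰`; (ii) the orbit space
`𝒢⁰/𝓡` is compact, Hausdorff and totally disconnected; (iii) the canonical projection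
`q : 𝒢⁰ → 𝒢⁰/𝓡` is a local homeomorphism. -/
theorem compact_principal_orbit_space (G : Type u) [AmpleGroupoid G]
    [CompactSpace G] [T2Space G] (hprin : IsPrincipal G) :
    (Topology.IsEmbedding (fun g : G =>
        ((⟨rng g, src_rng g⟩ : unitSpace G), (⟨src g, src_src g⟩ : unitSpace G))) ∧
      IsClosed (Set.range fun g : G =>
        ((⟨rng g, src_rng g⟩ : unitSpace G), (⟨src g, src_src g⟩ : unitSpace G)))) ∧
    (CompactSpace (Quot (orbitRel G)) ∧ T2Space (Quot (orbitRel G)) ∧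
      TotallyDisconnectedSpace (Quot (orbitRel G))) ∧
    IsLocalHomeomorph (Quot.mk (orbitRel G)) := by
  have hemb := AmpleGroupoid.isClosedEmbedding_rng_src hprin
  have := AmpleGroupoid.compactSpace_unitSpace (G := G)
  have := AmpleGroupoid.t2Space_quot_orbitRel hemb.isClosed_range
  exact ⟨⟨hemb.isEmbedding, hemb.isClosed_range⟩,
    ⟨Quot.compactSpace, this, AmpleGroupoid.totallyDisconnectedSpace_quot_orbitRel⟩,
    AmpleGroupoid.isLocalHomeomorph_quot_mk_orbitRel hemb.isEmbedding⟩
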